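/- If X is simple and nonatomic, then X is asymptotically aperiodic. -/

import Mathlib

open MeasureTheory Filter Set ProbabilityTheory

/-- A discrete-time Markov chain on a state space `S`: a stochastic transition
matrix `P`, an initial distribution `init`, and the induced probability measure
`μ` on the path space `ℕ → S`, determined by its values on cylinder sets. -/
structure MarkovChain (S : Type) [MeasurableSpace S] where
  P : S → S → ℝ
  P_nonneg : ∀ i j, 0 ≤ P i j
  P_stochastic : ∀ i, HasSum (P i) 1
  init : S → ℝ
  init_nonneg : ∀ i, 0 ≤ init i
  init_hasSum : HasSum init 1
  μ : Measure (ℕ → S)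
  μ_prob : IsProbabilityMeasure μ
  μ_cylinder : ∀ (n : ℕ) (s : ℕ → S),
    μ {ω | ∀ k ≤ n, ω k = s k}
      = ENNReal.ofReal (init (s 0) * ∏ k ∈ Finset.range n, P (s k) (s (k + 1)))

namespace MarkovChain

variable {S : Type} [MeasurableSpace S]

open Classical in
/-- The `n`-step transition probabilities `P^n(i,j)`. -/
noncomputable def Pn (X : MarkovChain S) : ℕ → S → S → ℝ
  | 0, i, j => if i = j then 1 else 0
  | n + 1, i, j => ∑' k : S, X.Pn n i k * X.P k j

/-- Irreducibility: every state can be reached from every state. -/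
def Irreducible (X : MarkovChain S) : Prop := ∀ i j : S, ∃ n : ℕ, 0 < X.Pn n i j

/-- Aperiodicity: for each state, the gcd of the set `{n ≥ 1 | P^n(i,i) > 0}`
is `1` (expressed via common divisors). -/
def Aperiodic (X : MarkovChain S) : Prop :=
  ∀ i : S, ∀ d : ℕ, (∀ n : ℕ, 0 < n → 0 < X.Pn n i i → d ∣ n) → d = 1

/-- `U^(m)(C)`: the event that the `m`-step chain visits `C` infinitely often. -/
def U (X : MarkovChain S) (m : ℕ) (C : Set S) : Set (ℕ → S) :=
  {ω | ∀ n : ℕ, ∃ k : ℕ, n ≤ k ∧ ω (k * m) ∈ C}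

/-- `L^(m)(C)`: the event that the `m`-step chain is eventually in `C`. -/
def L (X : MarkovChain S) (m : ℕ) (C : Set S) : Set (ℕ → S) :=
  {ω | ∃ n : ℕ, ∀ k : ℕ, n ≤ k → ω (k * m) ∈ C}

/-- `C` is transient with respect to the `m`-step chain `X^(m)`. -/
def Transient (X : MarkovChain S) (m : ℕ) (C : Set S) : Prop := X.μ (X.U m C) = 0

/-- `C` is regular with respect to `X^(m)`: `U^(m)(C)` and `L^(m)(C)` agree up
to a null event. -/
def Regular (X : MarkovChain S) (m : ℕ) (C : Set S) : Prop :=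
  X.μ (symmDiff (X.U m C) (X.L m C)) = 0

/-- `C` is almost closed with respect to `X^(m)`: regular but not transient. -/
def AlmostClosed (X : MarkovChain S) (m : ℕ) (C : Set S) : Prop :=
  X.Regular m C ∧ ¬ X.Transient m C

/-- An almost closed set is atomic if it does not contain two disjoint almost
closed subsets. -/
def Atomic (X : MarkovChain S) (m : ℕ) (C : Set S) : Prop :=
  X.AlmostClosed m C ∧
    ¬ ∃ A B : Set S, A ⊆ C ∧ B ⊆ C ∧ Disjoint A B ∧
      X.AlmostClosed m A ∧ X.AlmostClosed m B

/-- A Blackwell decomposition for the `m`-step chain `X^(m)`: a countable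
collection of pairwise disjoint almost closed sets, all atomic except at most
one, where a nonatomic member contains no atomic subsets and consists of
transient states, and such that the probabilities `μ(L^(m)(C))` sum to one. -/
structure IsBlackwell (X : MarkovChain S) (m : ℕ) (𝒞 : Set (Set S)) : Prop where
  countable : 𝒞.Countable
  almostClosed : ∀ C ∈ 𝒞, X.AlmostClosed m C
  disjoint : 𝒞.PairwiseDisjoint id
  atMostOneNonatomic : ∀ C₁ ∈ 𝒞, ∀ C₂ ∈ 𝒞, ¬ X.Atomic m C₁ → ¬ X.Atomic m C₂ → C₁ = C₂
  nonatomicNoAtomicSubset : ∀ C ∈ 𝒞, ¬ X.Atomic m C → ∀ A : Set S, A ⊆ C → ¬ X.Atomic m A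
  nonatomicTransientStates : ∀ C ∈ 𝒞, ¬ X.Atomic m C → ∀ i ∈ C, X.Transient m {i}
  sum_L_eq_one : ∑' C : 𝒞, X.μ (X.L m (C : Set S)) = 1

/-- `β(X^(m))`: the number of sets in a Blackwell decomposition for `X^(m)`
(well defined since the decomposition is unique up to equivalence). -/
noncomputable def beta (X : MarkovChain S) (m : ℕ) : ℕ∞ :=
  sInf (Set.encard '' {𝒞 : Set (Set S) | X.IsBlackwell m 𝒞})

/-- `X` is simple if `β(X) = 1`. -/
def Simple (X : MarkovChain S) : Prop := X.beta 1 = 1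

/-- The asymptotic period `d(X) = sup {m ≥ 1 | β(X^(m)) = m}` (possibly `∞`). -/
noncomputable def period (X : MarkovChain S) : ℕ∞ :=
  sSup {d : ℕ∞ | ∃ m : ℕ, 1 ≤ m ∧ X.beta m = (m : ℕ∞) ∧ d = (m : ℕ∞)}

/-- Recurrence: every state is visited infinitely often almost surely. -/
def Recurrent (X : MarkovChain S) : Prop := ∀ i : S, X.μ (X.U 1 {i}) = 1

end MarkovChain

/-- The shift operator `θ` on path space: `(θ ω)(n) = ω(n+1)`. -/
def pathShift {S : Type} : (ℕ → S) → ℕ → S := fun ω n => ω (n + 1)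

/-- An event `E` is `m`-invariant if its indicator function `f` satisfies
`f(ω) = f(θ^m ω)` for all paths `ω`. -/
def MInvariant {S : Type} (m : ℕ) (E : Set (ℕ → S)) : Prop :=
  ∀ ω : ℕ → S, ω ∈ E ↔ pathShift^[m] ω ∈ E

/-- A birth-death process: a Markov chain on `ℕ` with positive birth
probabilities `p_i = P(i,i+1)`, positive death probabilities `q_{i+1} = P(i+1,i)`,
all transition probabilities other than `p_i`, `q_i` and `r_i = P(i,i)` zero,
and at least one positive self-transition probability. -/
structure MarkovChain.IsBirthDeath (X : MarkovChain ℕ) : Prop where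
  birth_pos : ∀ i : ℕ, 0 < X.P i (i + 1)
  death_pos : ∀ i : ℕ, 0 < X.P (i + 1) i
  tridiagonal : ∀ i j : ℕ, 1 < |(i : ℤ) - (j : ℤ)| → X.P i j = 0
  self_pos : ∃ i : ℕ, 0 < X.P i i

namespace MarkovChain

section

variable {S : Type} [MeasurableSpace S] {X : MarkovChain S} {m : ℕ} {A B C D : Set S}

theorem mem_L_iff {ω : ℕ → S} : ω ∈ X.L m C ↔ ∀ᶠ k in atTop, ω (k * m) ∈ C :=
  eventually_atTop.symm

theorem mem_U_iff {ω : ℕ → S} : ω ∈ X.U m C ↔ ∃ᶠ k in atTop, ω (k * m) ∈ C :=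
  frequently_atTop.symm

theorem L_subset_U : X.L m C ⊆ X.U m C := fun _ h =>
  mem_U_iff.2 (mem_L_iff.1 h).frequently

theorem L_mono (h : C ⊆ D) : X.L m C ⊆ X.L m D := fun _ hω =>
  mem_L_iff.2 ((mem_L_iff.1 hω).mono fun _ hk => h hk)

theorem L_inter : X.L m (C ∩ D) = X.L m C ∩ X.L m D := by
  ext ω
  simp only [mem_inter_iff, mem_L_iff, eventually_and]

theorem disjoint_L (h : Disjoint C D) : Disjoint (X.L m C) (X.L m D) := by
  rw [Set.disjoint_left]
  intro ω hC hD
  obtain ⟨k, hk⟩ := ((mem_L_iff.1 hC).and (mem_L_iff.1 hD)).exists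
  exact Set.disjoint_left.1 h hk.1 hk.2

theorem L_one_subset_L (hm : 1 ≤ m) : X.L 1 C ⊆ X.L m C := by
  intro ω h
  rw [mem_L_iff] at h ⊢
  simp only [mul_one] at h
  exact (tendsto_id.atTop_mul_const' (by omega : 0 < m)).eventually h

theorem U_subset_U_one (hm : 1 ≤ m) : X.U m C ⊆ X.U 1 C := by
  intro ω h
  rw [mem_U_iff] at h ⊢
  simp only [mul_one]
  exact (tendsto_id.atTop_mul_const' (by omega : 0 < m)).frequently h

theorem regular_iff : X.Regular m C ↔ ∀ᵐ ω ∂X.μ, ω ∈ X.U m C → ω ∈ X.L m C := by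
  rw [Regular, ae_iff, Set.symmDiff_def, sdiff_eq_empty.2 L_subset_U, union_empty]
  simp only [Classical.not_imp]
  rfl

theorem Regular.inter (hC : X.Regular m C) (hD : X.Regular m D) : X.Regular m (C ∩ D) := by
  rw [regular_iff] at *
  filter_upwards [hC, hD] with ω h1 h2 h
  rw [L_inter]
  rw [mem_U_iff] at h
  exact ⟨h1 (mem_U_iff.2 (h.mono fun _ hk => hk.1)), h2 (mem_U_iff.2 (h.mono fun _ hk => hk.2))⟩

theorem notMem_L_iff {ω : ℕ → S} : ω ∉ X.L m C ↔ ω ∈ X.U m Cᶜ := by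
  rw [mem_L_iff, mem_U_iff, not_eventually]
  rfl

theorem notMem_U_iff {ω : ℕ → S} : ω ∉ X.U m C ↔ ω ∈ X.L m Cᶜ := by
  rw [mem_L_iff, mem_U_iff, not_frequently]
  rfl

theorem Regular.compl (hC : X.Regular m C) : X.Regular m Cᶜ := by
  rw [regular_iff] at *
  filter_upwards [hC] with ω h hU
  rw [← notMem_U_iff]
  exact fun h' => notMem_L_iff.2 hU (h h')

theorem Regular.ae_mem_L_or (hC : X.Regular m C) :
    ∀ᵐ ω ∂X.μ, ω ∈ X.L m C ∨ ω ∈ X.L m Cᶜ := by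
  filter_upwards [regular_iff.1 hC] with ω h
  rw [← notMem_U_iff]
  tauto

theorem Regular.of_one (hm : 1 ≤ m) (hC : X.Regular 1 C) : X.Regular m C := by
  rw [regular_iff] at *
  filter_upwards [hC] with ω h hU
  exact L_one_subset_L hm (h (U_subset_U_one hm hU))

theorem Regular.transient_iff (hC : X.Regular m C) : X.Transient m C ↔ X.μ (X.L m C) = 0 := by
  rw [Transient]
  refine ⟨fun h => measure_mono_null L_subset_U h, fun h => ?_⟩
  rw [measure_eq_zero_iff_ae_notMem] at *
  filter_upwards [regular_iff.1 hC, h] with ω h1 h2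
  tauto

theorem almostClosed_iff : X.AlmostClosed m C ↔ X.Regular m C ∧ X.μ (X.L m C) ≠ 0 :=
  and_congr_right fun h => not_congr h.transient_iff

theorem measurableSet_L [MeasurableSingletonClass S] [Countable S] :
    MeasurableSet (X.L m C) := by
  have : X.L m C = ⋃ n : ℕ, ⋂ k : ℕ, ⋂ _ : n ≤ k, (fun ω : ℕ → S => ω (k * m)) ⁻¹' C := by
    ext ω
    simp [L]
  rw [this]
  exact .iUnion fun n => .iInter fun k => .iInter fun _ =>
    measurable_pi_apply _ C.to_countable.measurableSet

/-- On an atomic set of the `m`-step chain, every regular set of the one-step chain is trivial. -/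
theorem Atomic.measure_inter_eq_zero_or (hm : 1 ≤ m) (hA : X.Atomic m A) (hD : X.Regular 1 D) :
    X.μ (X.L m A ∩ X.L 1 D) = 0 ∨ X.μ (X.L m A \ X.L 1 D) = 0 := by
  by_contra! h
  refine hA.2 ⟨A ∩ D, A ∩ Dᶜ, inter_subset_left, inter_subset_left,
    disjoint_compl_right.mono inter_subset_right inter_subset_right,
    almostClosed_iff.2 ⟨hA.1.1.inter (hD.of_one hm), fun h0 => h.1 ?_⟩,
    almostClosed_iff.2 ⟨hA.1.1.inter (hD.compl.of_one hm), fun h0 => h.2 ?_⟩⟩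
  · rw [L_inter] at h0
    exact measure_mono_null (inter_subset_inter_right _ (L_one_subset_L hm)) h0
  · rw [L_inter, measure_eq_zero_iff_ae_notMem] at h0
    rw [measure_eq_zero_iff_ae_notMem]
    filter_upwards [h0, hD.ae_mem_L_or] with ω h1 h2 h3
    exact h1 ⟨h3.1, L_one_subset_L hm (h2.resolve_left h3.2)⟩

/-- If all states are transient, the tail events of countably many regular sets have an
intersection which is, up to a null event, the tail event of a regular set. -/
theorem exists_regular_ae_iff [MeasurableSingletonClass S] [Countable S]
    (htr : ∀ i, X.Transient 1 {i}) {D : ℕ → Set S} (hD : ∀ n, X.Regular 1 (D n)) :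
    ∃ E ⊆ D 0, X.Regular 1 E ∧ ∀ᵐ ω ∂X.μ, ω ∈ X.L 1 E ↔ ∀ n, ω ∈ X.L 1 (D n) := by
  have := X.μ_prob
  obtain ⟨e, he⟩ := Countable.exists_injective_nat S
  let G : ℕ → ℕ → Set (ℕ → S) := fun n j =>
    X.L 1 (D n) ∩ {ω | ∃ k, ω k ∉ D n ∧ j ≤ e (ω k)}
  have hGmeas : ∀ n j, MeasurableSet (G n j) := by
    intro n j
    refine measurableSet_L.inter ?_
    have : {ω : ℕ → S | ∃ k, ω k ∉ D n ∧ j ≤ e (ω k)} =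
        ⋃ k : ℕ, (fun ω : ℕ → S => ω k) ⁻¹' {i | i ∉ D n ∧ j ≤ e i} := by
      ext ω
      simp
    rw [this]
    exact .iUnion fun k => measurable_pi_apply _ (Set.to_countable _).measurableSet
  have hGanti : ∀ n, Antitone (G n) := by
    rintro n j j' hj ω ⟨h1, k, h2, h3⟩
    exact ⟨h1, k, h2, hj.trans h3⟩
  have hGempty : ∀ n, ⋂ j, G n j = ∅ := by
    intro n
    rw [eq_empty_iff_forall_notMem]
    intro ω hω
    rw [mem_iInter] at hω
    obtain ⟨N, hN⟩ := (hω 0).1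
    obtain ⟨-, k, hk, hk'⟩ := hω (∑ k ∈ Finset.range N, (e (ω k) + 1))
    have hkN : k < N := by
      by_contra! hle
      exact hk (by simpa using hN k hle)
    have := Finset.single_le_sum (f := fun k => e (ω k) + 1) (fun _ _ => Nat.zero_le _)
      (Finset.mem_range.2 hkN)
    omega
  have hsmall : ∀ n, ∃ j, X.μ (G n j) ≤ (2⁻¹ : ENNReal) ^ n := by
    intro n
    have h := tendsto_measure_iInter_atTop (μ := X.μ)
      (fun j => (hGmeas n j).nullMeasurableSet) (hGanti n) ⟨0, measure_ne_top _ _⟩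
    rw [hGempty, measure_empty] at h
    have hpos : (0 : ENNReal) < 2⁻¹ ^ n := by
      refine pos_iff_ne_zero.2 (pow_ne_zero _ ?_)
      simp
    exact ((h.eventually (gt_mem_nhds hpos)).exists).imp fun _ h => h.le
  choose j hj using hsmall
  have hBC : ∀ᵐ ω ∂X.μ, ∀ᶠ n in atTop, ω ∉ G n (j n) := by
    refine ae_eventually_notMem (ne_top_of_le_ne_top ?_ (ENNReal.tsum_le_tsum hj))
    rw [ENNReal.tsum_geometric]
    simp
  have hleave : ∀ᵐ ω ∂X.μ, ∀ N, ∀ᶠ k in atTop, N ≤ e (ω k) := by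
    have h1 : ∀ᵐ ω ∂X.μ, ∀ i, ω ∉ X.U 1 {i} :=
      ae_all_iff.2 fun i => measure_eq_zero_iff_ae_notMem.1 (htr i)
    filter_upwards [h1] with ω h N
    have hfin : {i | e i < N}.Finite := (Set.finite_lt_nat N).preimage he.injOn
    have : ∀ᶠ k in atTop, ∀ i ∈ {i | e i < N}, ω k ≠ i := by
      rw [hfin.eventually_all]
      intro i _
      have := h i
      rw [mem_U_iff, not_frequently] at this
      simpa using this
    filter_upwards [this] with k hk
    by_contra! hlt
    exact hk (ω k) hlt rfl
  let E : Set S := {i | i ∈ D 0 ∧ ∀ n, j n ≤ e i → i ∈ D n}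
  have hpos : ∀ᵐ ω ∂X.μ, (∀ n, ω ∈ X.L 1 (D n)) → ω ∈ X.L 1 E := by
    filter_upwards [hBC] with ω h1 hω
    simp only [mem_L_iff, mul_one] at hω ⊢
    obtain ⟨N, hN⟩ := eventually_atTop.1 h1
    have h2 : ∀ᶠ k in atTop, ∀ n ∈ {n | n < N}, ω k ∈ D n :=
      (Set.finite_lt_nat N).eventually_all.2 fun n _ => hω n
    filter_upwards [h2, hω 0] with k hk hk0
    refine ⟨hk0, fun n hn => ?_⟩
    by_cases hnN : n < N
    · exact hk n hnN
    · by_contra hbad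
      exact hN n (not_lt.1 hnN) ⟨by simpa only [mem_L_iff, mul_one] using hω n, k, hbad, hn⟩
  have hneg : ∀ᵐ ω ∂X.μ, ω ∈ X.U 1 E → ∀ n, ω ∈ X.L 1 (D n) := by
    filter_upwards [hleave, ae_all_iff.2 fun n => (hD n).ae_mem_L_or] with ω h1 h2 hU n
    refine (h2 n).resolve_right fun hc => ?_
    simp only [mem_L_iff, mem_U_iff, mul_one] at hc hU
    obtain ⟨k, hkE, hkc, hk⟩ := (hU.and_eventually (hc.and (h1 (j n)))).exists
    exact hkc (hkE.2 n hk)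
  refine ⟨E, fun _ h => h.1, regular_iff.2 ?_, ?_⟩
  · filter_upwards [hpos, hneg] with ω h1 h2 h
    exact h1 (h2 h)
  · filter_upwards [hpos, hneg] with ω h1 h2
    exact ⟨fun h => h2 (L_subset_U h), h1⟩

/-- If all states are transient, an almost closed set of full measure contains an atomic set as
soon as some `m`-step chain has an atomic set. -/
theorem Atomic.exists_atomic_one [MeasurableSingletonClass S] [Countable S]
    (htr : ∀ i, X.Transient 1 {i}) (hC : X.Regular 1 C) (hCae : ∀ᵐ ω ∂X.μ, ω ∈ X.L 1 C)
    (hm : 1 ≤ m) (hA : X.Atomic m A) : ∃ D ⊆ C, X.Atomic 1 D := by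
  have := X.μ_prob
  have hApos : X.μ (X.L m A) ≠ 0 := (almostClosed_iff.1 hA.1).2
  let 𝒟 : Set (Set S) := {D | D ⊆ C ∧ X.Regular 1 D ∧ X.μ (X.L m A \ X.L 1 D) = 0}
  have hne : C ∈ 𝒟 := by
    refine ⟨Subset.rfl, hC, ?_⟩
    rw [measure_eq_zero_iff_ae_notMem]
    filter_upwards [hCae] with ω h h'
    exact h'.2 h
  obtain ⟨v, -, hv, hmem⟩ := exists_seq_tendsto_sInf
    (S := (fun D => X.μ (X.L 1 D)) '' 𝒟) ⟨_, mem_image_of_mem _ hne⟩ (OrderBot.bddBelow _)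
  choose D hD hDv using hmem
  obtain ⟨E, hE0, hEreg, hE⟩ := exists_regular_ae_iff htr fun n => (hD n).2.1
  have hEsub : E ⊆ C := hE0.trans (hD 0).1
  have hEA : X.μ (X.L m A \ X.L 1 E) = 0 := by
    have h : ∀ᵐ ω ∂X.μ, ∀ n, ω ∉ X.L m A \ X.L 1 (D n) :=
      ae_all_iff.2 fun n => measure_eq_zero_iff_ae_notMem.1 (hD n).2.2
    rw [measure_eq_zero_iff_ae_notMem]
    filter_upwards [h, hE] with ω h1 h2 h3
    exact h3.2 (h2.2 fun n => by_contra fun h4 => h1 n ⟨h3.1, h4⟩)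
  have hmin : ∀ F ∈ 𝒟, X.μ (X.L 1 E) ≤ X.μ (X.L 1 F) := by
    intro F hF
    refine le_trans (ge_of_tendsto' hv fun n => ?_)
      (csInf_le (OrderBot.bddBelow _) (mem_image_of_mem _ hF))
    rw [← hDv n]
    refine measure_mono_ae ?_
    filter_upwards [hE] with ω h1 h2
    exact h1.1 h2 n
  have key : ∀ F ⊆ E, X.AlmostClosed 1 F → X.μ (X.L m A \ X.L 1 F) = 0 := by
    intro F hFE hF
    rw [almostClosed_iff] at hF
    refine (hA.measure_inter_eq_zero_or hm hF.1).resolve_left fun h0 => ?_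
    have hmem : E ∩ Fᶜ ∈ 𝒟 := by
      refine ⟨inter_subset_left.trans hEsub, hEreg.inter hF.1.compl, ?_⟩
      rw [measure_eq_zero_iff_ae_notMem] at h0 hEA ⊢
      filter_upwards [h0, hEA, hF.1.ae_mem_L_or] with ω h1 h2 h3 h4
      rw [L_inter] at h4
      have h5 : ω ∉ X.L 1 F := fun h => h1 ⟨h4.1, h⟩
      have h6 : ω ∈ X.L 1 E := by_contra fun h => h2 ⟨h4.1, h⟩
      exact h4.2 ⟨h6, h3.resolve_left h5⟩
    have hdisj : Disjoint (X.L 1 (E ∩ Fᶜ)) (X.L 1 F) :=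
      disjoint_L (disjoint_compl_left.mono_left inter_subset_right)
    have hle : X.μ (X.L 1 (E ∩ Fᶜ)) + X.μ (X.L 1 F) ≤ X.μ (X.L 1 E) := by
      rw [← measure_union hdisj measurableSet_L]
      exact measure_mono (union_subset (L_mono inter_subset_left) (L_mono hFE))
    have := ENNReal.lt_add_right (measure_ne_top X.μ (X.L 1 (E ∩ Fᶜ))) hF.2
    exact absurd (hmin _ hmem) (not_le.2 (this.trans_le hle))
  refine ⟨E, hEsub, almostClosed_iff.2 ⟨hEreg, fun h0 => hApos ?_⟩, ?_⟩
  · exact measure_mono_null (fun ω h => by_cases (p := ω ∈ X.L 1 E) Or.inl fun h' => Or.inr ⟨h, h'⟩)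
      (measure_union_null h0 hEA)
  · rintro ⟨F, G, hF, hG, hFG, hFc, hGc⟩
    refine hApos (measure_mono_null (fun ω h => ?_)
      (measure_union_null (key F hF hFc) (key G hG hGc)))
    by_cases hω : ω ∈ X.L 1 F
    · exact Or.inr ⟨h, Set.disjoint_left.1 (disjoint_L hFG) hω⟩
    · exact Or.inl ⟨h, hω⟩

theorem almostClosed_univ : X.AlmostClosed m univ := by
  have := X.μ_prob
  have h : X.L m univ = univ := eq_univ_of_forall fun ω => mem_L_iff.2 (by simp)
  refine almostClosed_iff.2 ⟨regular_iff.2 (by simp [h]), by simp [h]⟩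

theorem exists_isBlackwell_encard_eq_beta (h : X.beta m ≠ ⊤) :
    ∃ 𝒞, X.IsBlackwell m 𝒞 ∧ 𝒞.encard = X.beta m := by
  have hne : (Set.encard '' {𝒞 : Set (Set S) | X.IsBlackwell m 𝒞}).Nonempty := by
    by_contra hne
    rw [not_nonempty_iff_eq_empty] at hne
    exact h (by rw [beta, hne, sInf_empty])
  exact csInf_mem hne

/-- The `m`-step chains of a simple nonatomic chain have no atomic sets. -/
theorem Simple.not_atomic [MeasurableSingletonClass S] [Countable S] (hX : X.Simple)
    (hna : ¬ X.Atomic 1 univ) (hm : 1 ≤ m) (A : Set S) : ¬ X.Atomic m A := by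
  have := X.μ_prob
  obtain ⟨𝒞, h𝒞, hcard⟩ := exists_isBlackwell_encard_eq_beta (X := X) (m := 1)
    (by rw [hX]; exact ENat.one_ne_top)
  rw [hX, encard_eq_one] at hcard
  obtain ⟨C, rfl⟩ := hcard
  have hCac := h𝒞.almostClosed C rfl
  have hCae : ∀ᵐ ω ∂X.μ, ω ∈ X.L 1 C := by
    refine (mem_ae_iff_prob_eq_one (measurableSet_L (X := X))).2 ?_
    rw [← h𝒞.sum_L_eq_one, tsum_singleton C (fun C => X.μ (X.L 1 C))]
  have hCna : ¬ X.Atomic 1 C := by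
    refine fun hC => hna ⟨almostClosed_univ, ?_⟩
    rintro ⟨F, G, -, -, hFG, hF, hG⟩
    have key : ∀ F, X.AlmostClosed 1 F → X.AlmostClosed 1 (F ∩ C) := by
      intro F hF
      rw [almostClosed_iff] at hF ⊢
      refine ⟨hF.1.inter hCac.1, fun h0 => hF.2 ?_⟩
      rw [L_inter, measure_eq_zero_iff_ae_notMem] at h0
      rw [measure_eq_zero_iff_ae_notMem]
      filter_upwards [h0, hCae] with ω h1 h2 h3
      exact h1 ⟨h3, h2⟩
    exact hC.2 ⟨F ∩ C, G ∩ C, inter_subset_right, inter_subset_right,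
      hFG.mono inter_subset_left inter_subset_left, key F hF, key G hG⟩
  have htr : ∀ i, X.Transient 1 {i} := by
    intro i
    by_cases hi : i ∈ C
    · exact h𝒞.nonatomicTransientStates C rfl hCna i hi
    · rw [Transient, measure_eq_zero_iff_ae_notMem]
      filter_upwards [hCae] with ω h
      rw [notMem_U_iff]
      exact L_mono (fun x hx (hxi : x = i) => hi (hxi ▸ hx)) h
  intro hA
  obtain ⟨D, hDC, hD⟩ := hA.exists_atomic_one htr hCac.1 hCae hm
  exact h𝒞.nonatomicNoAtomicSubset C rfl hCna D hDC hD

end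

end MarkovChain

variable {S : Type} [MeasurableSpace S] [MeasurableSingletonClass S]
  [Countable S] [Infinite S]

/-- If `X` is simple and nonatomic, then `X` is asymptotically
aperiodic. -/
theorem stmt9 (X : MarkovChain S) (hirr : X.Irreducible) (hap : X.Aperiodic)
    (hsimple : X.Simple) (hnonatomic : ¬ X.Atomic 1 Set.univ) :
    X.period = 1 := by
  refine le_antisymm (sSup_le ?_) (le_sSup ⟨1, le_rfl, hsimple, rfl⟩)
  rintro _ ⟨m, hm, hbeta, rfl⟩
  obtain ⟨𝒞, h𝒞, hcard⟩ := MarkovChain.exists_isBlackwell_encard_eq_beta (X := X) (m := m)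
    (by rw [hbeta]; exact ENat.natCast_ne_top m)
  rw [← hbeta, ← hcard, encard_le_one_iff]
  exact fun A B hA hB => h𝒞.atMostOneNonatomic A hA B hB
    (hsimple.not_atomic hnonatomic hm A) (hsimple.not_atomic hnonatomic hm B)
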